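/- Let n ≥ 3, N ≥ 2, let h be a nondegenerate conjugate face-net on the faces of ℤ^N with values in ℝ^{n+1}∖{0}, and let A = ℤ^N ∩ ∏_{i=1}^N [0, a_i] be a block. Then there exist m ≥ 0, a surjective linear map P : ℝ^{n+1+m} → ℝ^{n+1} whose kernel has dimension m, and a map ĥ from the faces of ℤ^N incident to vertices of A into ℝ^{n+1+m}∖{0} such that: (1) for every vertex v ∈ A, the linear span Π̂(v) of the values of ĥ at the faces incident to v has dimension exactly 3 (ĥ is the restriction of a conjugate face-net); (2) P(ĥ(f)) is a nonzero scalar multiple of h(f) for every such face f (ĥ is a lift of h under the induced central projection); and (3) for every sub-block B = ℤ^N ∩ ∏_{i=1}^N [0, b_i] ⊆ A (0 ≤ b_i ≤ a_i), the linear span of ⋃_{v ∈ B} Π̂(v) has dimension exactly δ(B) + 3, where δ(B) := b_1 + ⋯ + b_N. -/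

import Mathlib

/-- A face `(r; {i,j})` of the lattice `ℤ^N`, with `i < j`. -/
structure LatFace (N : ℕ) where
  r : Fin N → ℤ
  i : Fin N
  j : Fin N
  hij : i < j

/-- The `i`-th standard basis vector of `ℤ^N`. -/
def ev {N : ℕ} (i : Fin N) : Fin N → ℤ := Pi.single i 1

/-- The four corner vertices of a face. -/
def LatFace.corners {N : ℕ} (f : LatFace N) : Set (Fin N → ℤ) :=
  {f.r, f.r + ev f.i, f.r + ev f.j, f.r + ev f.i + ev f.j}

/-- The block `ℤ^N ∩ ∏ᵢ [0, aᵢ]`. -/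
def blockSet {N : ℕ} (a : Fin N → ℕ) : Set (Fin N → ℤ) :=
  {v : Fin N → ℤ | ∀ t : Fin N, 0 ≤ v t ∧ v t ≤ (a t : ℤ)}

/-- The plane (in homogeneous coordinates: the linear span) at a vertex `v`,
spanned by the values of a face-net at the faces incident to `v`. -/
def facePlane {N n : ℕ} (h : LatFace N → (Fin (n + 1) → ℝ)) (v : Fin N → ℤ) :
    Submodule ℝ (Fin (n + 1) → ℝ) :=
  Submodule.span ℝ (h '' {f : LatFace N | v ∈ f.corners})

/-- A conjugate face-net: nonzero homogeneous coordinate vectors on the faces of `ℤ^N`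
such that the span of the values at the faces incident to any vertex is 3-dimensional. -/
def IsConjugateFaceNet {N n : ℕ} (h : LatFace N → (Fin (n + 1) → ℝ)) : Prop :=
  (∀ f, h f ≠ 0) ∧
  ∀ v : Fin N → ℤ, Module.finrank ℝ (facePlane h v) = 3

/-- Nondegeneracy of a conjugate face-net. -/
def IsNondegFaceNet {N n : ℕ} (h : LatFace N → (Fin (n + 1) → ℝ)) : Prop :=
  (∀ (v : Fin N → ℤ) (f₁ f₂ f₃ : LatFace N),
      f₁ ≠ f₂ → f₁ ≠ f₃ → f₂ ≠ f₃ →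
      v ∈ f₁.corners → v ∈ f₂.corners → v ∈ f₃.corners →
      Module.finrank ℝ
        (Submodule.span ℝ ({h f₁, h f₂, h f₃} : Set (Fin (n + 1) → ℝ))) = 3) ∧
  (∀ (f : LatFace N) (v v' v'' : Fin N → ℤ),
      v ≠ v' → v ≠ v'' → v' ≠ v'' →
      v ∈ f.corners → v' ∈ f.corners → v'' ∈ f.corners →
      Module.finrank ℝ ↥(facePlane h v ⊓ facePlane h v' ⊓ facePlane h v'') = 1)

/-- Under nondegeneracy, two vertices sharing three distinct faces have the same plane. -/
lemma facePlane_eq_of_three_faces {N n : ℕ} {h : LatFace N → (Fin (n + 1) → ℝ)}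
    (hconj : IsConjugateFaceNet h) (hnd : IsNondegFaceNet h) {v w : Fin N → ℤ}
    (f : Fin 3 → LatFace N) (hf : Function.Injective f)
    (hv : ∀ k, v ∈ (f k).corners) (hw : ∀ k, w ∈ (f k).corners) :
    facePlane h v = facePlane h w := by
  have hspan := hnd.1 v (f 0) (f 1) (f 2) (hf.ne (by decide)) (hf.ne (by decide))
    (hf.ne (by decide)) (hv 0) (hv 1) (hv 2)
  have key : ∀ u : Fin N → ℤ, (∀ k, u ∈ (f k).corners) →
      Submodule.span ℝ {h (f 0), h (f 1), h (f 2)} = facePlane h u := by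
    intro u hu
    refine Submodule.eq_of_le_of_finrank_eq (Submodule.span_mono ?_)
      (by rw [hspan, hconj.2 u])
    rintro x (rfl | rfl | rfl)
    exacts [⟨f 0, hu 0, rfl⟩, ⟨f 1, hu 1, rfl⟩, ⟨f 2, hu 2, rfl⟩]
  rw [← key v hv, ← key w hw]

/-- A nondegenerate conjugate face-net forces lattice dimension at most two: in higher
dimension every edge lies on at least four faces, so all planes would coincide. -/
lemma IsNondegFaceNet.dim_le_two {N n : ℕ} {h : LatFace N → (Fin (n + 1) → ℝ)}
    (hconj : IsConjugateFaceNet h) (hnd : IsNondegFaceNet h) : N ≤ 2 := by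
  by_contra! hN
  let a : Fin N := ⟨0, by omega⟩
  let b : Fin N := ⟨1, by omega⟩
  let c : Fin N := ⟨2, by omega⟩
  have hab : a < b := by simp [a, b, Fin.lt_def]
  have hac : a < c := by simp [a, c, Fin.lt_def]
  have hbc : b < c := by simp [b, c, Fin.lt_def]
  have hne : ∀ i : Fin N, ev i ≠ 0 := fun i => by simp [ev]
  have hevab : ev a ≠ ev b := by
    intro e
    have := congrFun e a
    simp [ev, hab.ne] at this
  have h1 : facePlane h 0 = facePlane h (ev a) := by
    refine facePlane_eq_of_three_faces hconj hnd
      ![⟨0, a, b, hab⟩, ⟨-ev b, a, b, hab⟩, ⟨0, a, c, hac⟩] ?_ ?_ ?_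
    · intro k l
      fin_cases k <;> fin_cases l <;> simp [hne, hbc.ne, hbc.ne']
    · intro k
      fin_cases k <;> simp [LatFace.corners]
    · intro k
      fin_cases k <;> simp [LatFace.corners, add_comm]
  have h2 : facePlane h 0 = facePlane h (ev b) := by
    refine facePlane_eq_of_three_faces hconj hnd
      ![⟨0, a, b, hab⟩, ⟨-ev a, a, b, hab⟩, ⟨0, b, c, hbc⟩] ?_ ?_ ?_
    · intro k l
      fin_cases k <;> fin_cases l <;> simp [hne, hab.ne, hab.ne']
    · intro k
      fin_cases k <;> simp [LatFace.corners]
    · intro k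
      fin_cases k <;> simp [LatFace.corners]
  have h3 := hnd.2 ⟨0, a, b, hab⟩ 0 (ev a) (ev b) (hne a).symm (hne b).symm hevab
    (by simp [LatFace.corners]) (by simp [LatFace.corners]) (by simp [LatFace.corners])
  rw [← h1, ← h2, inf_idem, inf_idem, hconj.2] at h3
  omega

/-- The face of `ℤ²` whose largest corner is `(p, q)`. -/
def planarFace (p q : ℤ) : LatFace 2 := ⟨![p - 1, q - 1], 0, 1, by decide⟩

lemma eq_planarFace (f : LatFace 2) : f = planarFace (f.r 0 + 1) (f.r 1 + 1) := by
  obtain ⟨r, i, j, hij⟩ := f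
  obtain ⟨rfl, rfl⟩ : i = 0 ∧ j = 1 := by
    fin_cases i <;> fin_cases j <;> simp_all
  have : r = ![r 0 + 1 - 1, r 1 + 1 - 1] := by
    ext t
    fin_cases t <;> simp
  simp only [planarFace, ← this]

lemma mem_corners_planarFace {v : Fin 2 → ℤ} {p q : ℤ} :
    v ∈ (planarFace p q).corners ↔ (p = v 0 ∨ p = v 0 + 1) ∧ (q = v 1 ∨ q = v 1 + 1) := by
  simp only [LatFace.corners, planarFace, ev, Set.mem_insert_iff, Set.mem_singleton_iff,
    funext_iff, Fin.forall_fin_two, Pi.add_apply, Matrix.cons_val_zero, Matrix.cons_val_one,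
    Pi.single_eq_same, ne_eq, one_ne_zero, zero_ne_one, not_false_eq_true,
    Pi.single_eq_of_ne]
  omega

lemma image_incident_faces {E : Type*} (g : LatFace 2 → E) (v : Fin 2 → ℤ) :
    g '' {f | v ∈ f.corners} =
      {g (planarFace (v 0) (v 1)), g (planarFace (v 0 + 1) (v 1)),
        g (planarFace (v 0) (v 1 + 1)), g (planarFace (v 0 + 1) (v 1 + 1))} := by
  ext x
  constructor
  · rintro ⟨f, hf, rfl⟩
    rw [Set.mem_ofPred_eq, eq_planarFace f, mem_corners_planarFace] at hf
    rw [eq_planarFace f]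
    obtain ⟨h1 | h1, h2 | h2⟩ := hf <;> rw [h1, h2] <;> simp
  · rintro (rfl | rfl | rfl | rfl) <;>
      exact ⟨_, mem_corners_planarFace.2 (by simp), rfl⟩

section QNet

variable {E : Type*} [AddCommGroup E] [Module ℝ E]

/-- The solution of the Laplace recursion with coefficients `α`, `β`, `γ` on the quadrant `ℕ²`
with prescribed values `A` on the first axis and `B` on the open second axis. -/
def laplaceNet (α β γ : ℕ → ℕ → ℝ) (A B : ℕ → E) : ℕ → ℕ → E
  | p, 0 => A p
  | 0, q + 1 => B q
  | p + 1, q + 1 =>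
    α p q • laplaceNet α β γ A B p q + β p q • laplaceNet α β γ A B (p + 1) q +
      γ p q • laplaceNet α β γ A B p (q + 1)
termination_by p q => p + q

variable {α β γ : ℕ → ℕ → ℝ} {A B : ℕ → E}

lemma laplaceNet_zero_right (p : ℕ) : laplaceNet α β γ A B p 0 = A p := by
  rw [laplaceNet]

lemma laplaceNet_zero_succ (q : ℕ) : laplaceNet α β γ A B 0 (q + 1) = B q := by
  rw [laplaceNet]

lemma laplaceNet_succ_succ (p q : ℕ) : laplaceNet α β γ A B (p + 1) (q + 1) =
    α p q • laplaceNet α β γ A B p q + β p q • laplaceNet α β γ A B (p + 1) q +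
      γ p q • laplaceNet α β γ A B p (q + 1) := by
  rw [laplaceNet]

lemma map_laplaceNet {F : Type*} [AddCommGroup F] [Module ℝ F] (P : E →ₗ[ℝ] F)
    {x : ℕ → ℕ → F} (hA : ∀ p, P (A p) = x p 0) (hB : ∀ q, P (B q) = x 0 (q + 1))
    (hx : ∀ p q, x (p + 1) (q + 1) =
      α p q • x p q + β p q • x (p + 1) q + γ p q • x p (q + 1)) (p q : ℕ) :
    P (laplaceNet α β γ A B p q) = x p q := by
  induction q generalizing p with
  | zero => rw [laplaceNet_zero_right, hA]
  | succ q ihq =>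
    induction p with
    | zero => rw [laplaceNet_zero_succ, hB]
    | succ p ihp => simp only [laplaceNet_succ_succ, map_add, map_smul, ihq, ihp, hx]

lemma laplaceNet_mem (S : Submodule ℝ E) {k l : ℕ} (hA : ∀ p ≤ k, A p ∈ S)
    (hB : ∀ q < l, B q ∈ S) {p q : ℕ} (hp : p ≤ k) (hq : q ≤ l) :
    laplaceNet α β γ A B p q ∈ S := by
  induction q generalizing p with
  | zero => rw [laplaceNet_zero_right]; exact hA p hp
  | succ q ihq =>
    induction p with
    | zero => rw [laplaceNet_zero_succ]; exact hB q hq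
    | succ p ihp =>
      rw [laplaceNet_succ_succ]
      exact S.add_mem (S.add_mem (S.smul_mem _ (ihq (by omega) (by omega)))
        (S.smul_mem _ (ihq hp (by omega)))) (S.smul_mem _ (ihp (by omega)))

/-- The plane spanned by an elementary quadrilateral of a Laplace net is spanned by three of
its points. -/
lemma span_laplaceNet_quad (p q : ℕ) :
    Submodule.span ℝ {laplaceNet α β γ A B p q, laplaceNet α β γ A B (p + 1) q,
      laplaceNet α β γ A B p (q + 1), laplaceNet α β γ A B (p + 1) (q + 1)} ≤
    Submodule.span ℝ (Set.range ![laplaceNet α β γ A B p q, laplaceNet α β γ A B (p + 1) q,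
      laplaceNet α β γ A B p (q + 1)]) := by
  have h0 := Submodule.subset_span (R := ℝ) (Set.mem_range_self (f :=
    ![laplaceNet α β γ A B p q, laplaceNet α β γ A B (p + 1) q,
      laplaceNet α β γ A B p (q + 1)]) 0)
  have h1 := Submodule.subset_span (R := ℝ) (Set.mem_range_self (f :=
    ![laplaceNet α β γ A B p q, laplaceNet α β γ A B (p + 1) q,
      laplaceNet α β γ A B p (q + 1)]) 1)
  have h2 := Submodule.subset_span (R := ℝ) (Set.mem_range_self (f :=
    ![laplaceNet α β γ A B p q, laplaceNet α β γ A B (p + 1) q,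
      laplaceNet α β γ A B p (q + 1)]) 2)
  rw [Submodule.span_le]
  rintro x (rfl | rfl | rfl | rfl)
  · exact h0
  · exact h1
  · exact h2
  · rw [laplaceNet_succ_succ]
    exact add_mem (add_mem (Submodule.smul_mem _ _ h0) (Submodule.smul_mem _ _ h1))
      (Submodule.smul_mem _ _ h2)

end QNet

/-- Every face value of a planar nondegenerate conjugate face-net is a combination of the three
other values at a common vertex. -/
lemma exists_laplace_coeff {n : ℕ} {h : LatFace 2 → (Fin (n + 1) → ℝ)}
    (hconj : IsConjugateFaceNet h) (hnd : IsNondegFaceNet h) (p q : ℤ) :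
    ∃ α β γ : ℝ, h (planarFace (p + 1) (q + 1)) =
      α • h (planarFace p q) + β • h (planarFace (p + 1) q) +
        γ • h (planarFace p (q + 1)) := by
  have hspan := hnd.1 ![p, q] (planarFace p q) (planarFace (p + 1) q) (planarFace p (q + 1))
    (by simp [planarFace]) (by simp [planarFace]) (by simp [planarFace])
    (mem_corners_planarFace.2 (by simp)) (mem_corners_planarFace.2 (by simp))
    (mem_corners_planarFace.2 (by simp))
  have himg : facePlane h ![p, q] = Submodule.span ℝ _ :=
    congrArg (Submodule.span ℝ) (image_incident_faces h ![p, q])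
  have heq : Submodule.span ℝ {h (planarFace p q), h (planarFace (p + 1) q),
      h (planarFace p (q + 1))} = facePlane h ![p, q] := by
    refine Submodule.eq_of_le_of_finrank_eq ?_ (by rw [hspan, hconj.2])
    rw [himg]
    refine Submodule.span_mono ?_
    rintro x (rfl | rfl | rfl) <;> simp
  have hmem : h (planarFace (p + 1) (q + 1)) ∈ facePlane h ![p, q] := by
    rw [himg]
    exact Submodule.subset_span (by simp)
  rw [← heq, Submodule.mem_span_triple] at hmem
  obtain ⟨α, β, γ, e⟩ := hmem
  exact ⟨α, β, γ, e.symm⟩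

/-- Vectors whose last `m` coordinates form distinct standard basis vectors are linearly
independent. -/
lemma linearIndependent_append_single {N m : ℕ} {ι : Type*} (u : ι → Fin N → ℝ) (e : ι → Fin m)
    (he : Function.Injective e) :
    LinearIndependent ℝ fun k => (Fin.append (u k) (Pi.single (e k) 1) : Fin (N + m) → ℝ) := by
  refine LinearIndependent.of_comp (LinearMap.funLeft ℝ ℝ (Fin.natAdd N)) ?_
  convert (Pi.basisFun ℝ (Fin m)).linearIndependent.comp e he using 1
  ext k t
  simp [LinearMap.funLeft_apply]

/-- A nondegenerate conjugate face-net admits, over any block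
`A ⊆ ℤ^N`, a lift (under a central projection induced by a surjective linear map
`P : ℝ^{n+1+m} → ℝ^{n+1}` with `m`-dimensional kernel) such that the span of the planes
`Π̂(v)` over any sub-block `B ⊆ A` has dimension exactly `δ(B) + 3`. -/
theorem lift_of_conjugate_face_net {n N : ℕ} (hn : 3 ≤ n) (hN : 2 ≤ N)
    (h : LatFace N → (Fin (n + 1) → ℝ))
    (hconj : IsConjugateFaceNet h) (hnd : IsNondegFaceNet h)
    (aa : Fin N → ℕ) :
    ∃ (m : ℕ) (P : (Fin (n + 1 + m) → ℝ) →ₗ[ℝ] (Fin (n + 1) → ℝ)),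
      Function.Surjective P ∧
      Module.finrank ℝ (LinearMap.ker P) = m ∧
      ∃ hl : LatFace N → (Fin (n + 1 + m) → ℝ),
        -- (1) the lift is (the restriction of) a conjugate face-net
        (∀ v ∈ blockSet aa, Module.finrank ℝ
            (Submodule.span ℝ (hl '' {f : LatFace N | v ∈ f.corners})) = 3) ∧
        -- (2) `hl` projects to `h` (up to nonzero scalars) on the faces incident to `A`
        (∀ f : LatFace N, (∃ v ∈ blockSet aa, v ∈ f.corners) →
          hl f ≠ 0 ∧ ∃ c : ℝ, c ≠ 0 ∧ P (hl f) = c • h f) ∧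
        -- (3) the span of the lifted planes over any sub-block `B` has
        -- dimension `δ(B) + 3`
        (∀ bb : Fin N → ℕ, (∀ t : Fin N, bb t ≤ aa t) →
          Module.finrank ℝ
            ↥(⨆ v ∈ blockSet bb,
                Submodule.span ℝ (hl '' {f : LatFace N | v ∈ f.corners})) =
            (∑ t : Fin N, bb t) + 3) := by
  obtain rfl : N = 2 := le_antisymm (hnd.dim_le_two hconj) hN
  choose α β γ hcoef using fun p q : ℕ => exists_laplace_coeff hconj hnd p q
  let x : ℕ → ℕ → Fin (n + 1) → ℝ := fun p q => h (planarFace p q)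
  let m := aa 0 + aa 1 + 3
  let P : (Fin (n + 1 + m) → ℝ) →ₗ[ℝ] (Fin (n + 1) → ℝ) :=
    LinearMap.funLeft ℝ ℝ (Fin.castAdd m)
  have hP : Function.Surjective P :=
    LinearMap.funLeft_surjective_of_injective _ _ _ (Fin.castAdd_injective _ _)
  have hker : Module.finrank ℝ (LinearMap.ker P) = m := by
    have := P.finrank_range_add_finrank_ker
    rw [LinearMap.range_eq_top.2 hP, finrank_top, Module.finrank_fin_fun,
      Module.finrank_fin_fun] at this
    omega
  let A : ℕ → Fin (n + 1 + m) → ℝ := fun p =>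
    Fin.append (x p 0) (Pi.single (Fin.ofNat m p) 1)
  let B : ℕ → Fin (n + 1 + m) → ℝ := fun q =>
    Fin.append (x 0 (q + 1)) (Pi.single (Fin.ofNat m (aa 0 + 2 + q)) 1)
  let X := laplaceNet α β γ A B
  have hPX : ∀ p q, P (X p q) = x p q := by
    refine map_laplaceNet P ?_ ?_ ?_
    · intro p; ext t; simp [P, A, LinearMap.funLeft_apply]
    · intro q; ext t; simp [P, B, LinearMap.funLeft_apply]
    · intro p q; simpa [x] using hcoef p q
  let hl : LatFace 2 → Fin (n + 1 + m) → ℝ := fun f => X (f.r 0 + 1).toNat (f.r 1 + 1).toNat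
  have hlX : ∀ p q : ℕ, hl (planarFace p q) = X p q := fun p q => by simp [hl, planarFace]
  have himg : ∀ p q : ℕ, hl '' {f | ![(p : ℤ), (q : ℤ)] ∈ f.corners} =
      {X p q, X (p + 1) q, X p (q + 1), X (p + 1) (q + 1)} := fun p q => by
    rw [image_incident_faces, ← hlX, ← hlX, ← hlX, ← hlX]
    simp
  have hblock : ∀ {bb : Fin 2 → ℕ} {v : Fin 2 → ℤ}, v ∈ blockSet bb →
      ∃ p q : ℕ, p ≤ bb 0 ∧ q ≤ bb 1 ∧ v = ![(p : ℤ), (q : ℤ)] := by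
    intro bb v hv
    have h0 := hv 0
    have h1 := hv 1
    refine ⟨(v 0).toNat, (v 1).toNat, by omega, by omega, ?_⟩
    ext t
    fin_cases t <;> simp [h0.1, h1.1]
  have hmem_block : ∀ {bb : Fin 2 → ℕ} {p q : ℕ}, p ≤ bb 0 → q ≤ bb 1 →
      ![(p : ℤ), (q : ℤ)] ∈ blockSet bb := by
    intro bb p q hp hq t
    fin_cases t <;> simp [hp, hq]
  have hPhl : ∀ f : LatFace 2, (∃ v ∈ blockSet aa, v ∈ f.corners) → P (hl f) = h f := by
    rintro f ⟨v, hv, hf⟩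
    rw [eq_planarFace f, mem_corners_planarFace] at hf
    have h0 := (hv 0).1
    have h1 := (hv 1).1
    obtain ⟨p, hp⟩ := Int.eq_ofNat_of_zero_le (show 0 ≤ f.r 0 + 1 by omega)
    obtain ⟨q, hq⟩ := Int.eq_ofNat_of_zero_le (show 0 ≤ f.r 1 + 1 by omega)
    rw [eq_planarFace f, hp, hq, hlX, hPX]
  refine ⟨m, P, hP, hker, hl, ?_, ?_, ?_⟩
  · intro v hv
    apply le_antisymm
    · obtain ⟨p, q, -, -, rfl⟩ := hblock hv
      rw [himg]
      exact (Submodule.finrank_mono (span_laplaceNet_quad p q)).trans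
        ((finrank_range_le_card _).trans_eq (by simp))
    · rw [← hconj.2 v, facePlane,
        ← Set.image_congr (s := {f : LatFace 2 | v ∈ f.corners})
          fun f hf => hPhl f ⟨v, hv, hf⟩, ← Set.image_image P hl,
        ← Submodule.map_span]
      exact Submodule.finrank_map_le _ _
  · intro f hf
    refine ⟨fun h0 => hconj.1 f ?_, 1, one_ne_zero, by rw [hPhl f hf, one_smul]⟩
    rw [← hPhl f hf, h0, map_zero]
  · intro bb hbb
    have hb0 := hbb 0
    have hb1 := hbb 1
    let Y : Fin (bb 0 + 2) ⊕ Fin (bb 1 + 1) → Fin (n + 1 + m) → ℝ :=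
      Sum.elim (fun p => A p) (fun q => B q)
    have hY : LinearIndependent ℝ Y := by
      convert linearIndependent_append_single
        (Sum.elim (fun p : Fin (bb 0 + 2) => x p 0) (fun q : Fin (bb 1 + 1) => x 0 (q + 1)))
        (Sum.elim (fun p : Fin (bb 0 + 2) => Fin.ofNat m p)
          (fun q : Fin (bb 1 + 1) => Fin.ofNat m (aa 0 + 2 + q))) ?_ using 1
      · ext k
        cases k <;> rfl
      · have hlt : ∀ k < m, (Fin.ofNat m k).val = k := fun k hk => Nat.mod_eq_of_lt hk
        rintro (⟨p, hp⟩ | ⟨p, hp⟩) (⟨q, hq⟩ | ⟨q, hq⟩) e <;>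
          simp only [Sum.elim_inl, Sum.elim_inr, Fin.ext_iff] at e <;>
          rw [hlt _ (by omega), hlt _ (by omega)] at e
        · simp [e]
        · omega
        · omega
        · simpa using e
    have hspan : ⨆ v ∈ blockSet bb, Submodule.span ℝ (hl '' {f : LatFace 2 | v ∈ f.corners}) =
        Submodule.span ℝ (Set.range Y) := by
      have hA : ∀ p ≤ bb 0 + 1, A p ∈ Submodule.span ℝ (Set.range Y) := fun p hp =>
        Submodule.subset_span ⟨Sum.inl ⟨p, by omega⟩, rfl⟩
      have hB : ∀ q < bb 1 + 1, B q ∈ Submodule.span ℝ (Set.range Y) := fun q hq =>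
        Submodule.subset_span ⟨Sum.inr ⟨q, hq⟩, rfl⟩
      apply le_antisymm
      · refine iSup₂_le fun v hv => ?_
        obtain ⟨p, q, hp, hq, rfl⟩ := hblock hv
        rw [himg, Submodule.span_le]
        rintro y (rfl | rfl | rfl | rfl) <;>
          exact laplaceNet_mem _ hA hB (by omega) (by omega)
      · have hle : ∀ {p q : ℕ} {y : Fin (n + 1 + m) → ℝ}, p ≤ bb 0 → q ≤ bb 1 →
            y ∈ ({X p q, X (p + 1) q, X p (q + 1), X (p + 1) (q + 1)} : Set _) →
            y ∈ ⨆ v ∈ blockSet bb,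
              Submodule.span ℝ (hl '' {f : LatFace 2 | v ∈ f.corners}) := by
          intro p q y hp hq hy
          rw [← himg] at hy
          exact le_iSup₂ (f := fun v (_ : v ∈ blockSet bb) =>
            Submodule.span ℝ (hl '' {f : LatFace 2 | v ∈ f.corners})) _ (hmem_block hp hq)
            (Submodule.subset_span hy)
        rw [Submodule.span_le]
        rintro _ ⟨⟨p, hp⟩ | ⟨q, hq⟩, rfl⟩
        · change A p ∈ _
          rw [← laplaceNet_zero_right (α := α) (β := β) (γ := γ) (A := A) (B := B) p]
          rcases Nat.lt_or_ge p (bb 0 + 1) with hp' | hp'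
          · exact hle (p := p) (q := 0) (by omega) (by omega) (by simp [X])
          · obtain rfl : p = bb 0 + 1 := by omega
            exact hle (p := bb 0) (q := 0) le_rfl (by omega) (by simp [X])
        · change B q ∈ _
          rw [← laplaceNet_zero_succ (α := α) (β := β) (γ := γ) (A := A) (B := B) q]
          exact hle (p := 0) (q := q) (by omega) (by omega) (by simp [X])
    rw [hspan, finrank_span_eq_card hY]
    simp
    omega
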